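/- There exists a constant C > 0 such that the following holds. Let η : ℝ² → ℝ be smooth with η(x) > 0 for all x, and define q₀, w₁, w₂, w₃ as in the context. Then for every x ∈ ℝ²: ∫₀^{η(x)} |w(x,z)|² dz ≤ C·( |∇_x η(x)|²/η(x) + |∇_x η(x)|⁴/η(x) + η(x)·|Δ_x η(x)|² ), where |w| denotes the Euclidean norm of (w₁,w₂,w₃). -/

import Mathlib

noncomputable section

/-- Partial derivative of `f : ℝ² → ℝ` in the first horizontal variable. -/
def pdx1 (f : ℝ × ℝ → ℝ) (x : ℝ × ℝ) : ℝ := deriv (fun s => f (s, x.2)) x.1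

/-- Partial derivative of `f : ℝ² → ℝ` in the second horizontal variable. -/
def pdx2 (f : ℝ × ℝ → ℝ) (x : ℝ × ℝ) : ℝ := deriv (fun s => f (x.1, s)) x.2

/-- Horizontal Laplacian of `f : ℝ² → ℝ`. -/
def lapx (f : ℝ × ℝ → ℝ) (x : ℝ × ℝ) : ℝ := pdx1 (pdx1 f) x + pdx2 (pdx2 f) x

/-- The pressure-like quantity `q₀ = −6/η²`. -/
def q0 (η : ℝ × ℝ → ℝ) (x : ℝ × ℝ) : ℝ := -6 / (η x) ^ 2

/-- First component of the test function: `w₁(x,z) = ½ z (z − η(x)) ∂₁q₀(x)`. -/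
def w1 (η : ℝ × ℝ → ℝ) (x : ℝ × ℝ) (z : ℝ) : ℝ :=
  (1 / 2) * z * (z - η x) * pdx1 (q0 η) x

/-- Second component of the test function: `w₂(x,z) = ½ z (z − η(x)) ∂₂q₀(x)`. -/
def w2 (η : ℝ × ℝ → ℝ) (x : ℝ × ℝ) (z : ℝ) : ℝ :=
  (1 / 2) * z * (z - η x) * pdx2 (q0 η) x

/-- Third component of the test function:
`w₃(x,z) = (1/12) z² (3η − 2z) Δ_x q₀ + ¼ z² ∇_xη·∇_x q₀`. -/
def w3 (η : ℝ × ℝ → ℝ) (x : ℝ × ℝ) (z : ℝ) : ℝ :=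
  (1 / 12) * z ^ 2 * (3 * η x - 2 * z) * lapx (q0 η) x
    + (1 / 4) * z ^ 2 * (pdx1 η x * pdx1 (q0 η) x + pdx2 η x * pdx2 (q0 η) x)

/-- Partial derivative in the first horizontal variable of a function of `(x,z) ∈ ℝ² × ℝ`. -/
def pd1 (f : ℝ × ℝ → ℝ → ℝ) (x : ℝ × ℝ) (z : ℝ) : ℝ := deriv (fun s => f (s, x.2) z) x.1

/-- Partial derivative in the second horizontal variable of a function of `(x,z) ∈ ℝ² × ℝ`. -/
def pd2 (f : ℝ × ℝ → ℝ → ℝ) (x : ℝ × ℝ) (z : ℝ) : ℝ := deriv (fun s => f (x.1, s) z) x.2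

/-- Partial derivative in the vertical variable `z` of a function of `(x,z) ∈ ℝ² × ℝ`. -/
def pd3 (f : ℝ × ℝ → ℝ → ℝ) (x : ℝ × ℝ) (z : ℝ) : ℝ := deriv (f x) z

end

/-- Squared Euclidean norm of the horizontal gradient of `η`. -/
noncomputable def gradSq (η : ℝ × ℝ → ℝ) (x : ℝ × ℝ) : ℝ :=
  (pdx1 η x) ^ 2 + (pdx2 η x) ^ 2

theorem deriv_neg_six_div_sq {f : ℝ → ℝ} (hf : Differentiable ℝ f) (hpos : ∀ s, 0 < f s)
    (s : ℝ) : deriv (fun t => -6 / f t ^ 2) s = 12 * deriv f s / f s ^ 3 := by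
  have hs := (hpos s).ne'
  have h := (hasDerivAt_const s (-6 : ℝ)).fun_div ((hf s).hasDerivAt.fun_pow 2) (pow_ne_zero 2 hs)
  rw [h.deriv]
  push_cast
  field_simp
  ring

theorem deriv_deriv_neg_six_div_sq {f : ℝ → ℝ} (hf : ContDiff ℝ 2 f) (hpos : ∀ s, 0 < f s)
    (s : ℝ) : deriv (fun r => deriv (fun t => -6 / f t ^ 2) r) s =
      12 * deriv (deriv f) s / f s ^ 3 - 36 * deriv f s ^ 2 / f s ^ 4 := by
  have hdf : Differentiable ℝ f := hf.differentiable (by norm_num)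
  have hddf : Differentiable ℝ (deriv f) := by
    have h := hf.differentiable_iteratedDeriv 1 (by norm_num)
    rwa [iteratedDeriv_one] at h
  rw [funext (deriv_neg_six_div_sq hdf hpos)]
  have hs := (hpos s).ne'
  have h := ((hddf s).hasDerivAt.const_mul 12).fun_div ((hdf s).hasDerivAt.fun_pow 3)
    (pow_ne_zero 3 hs)
  rw [h.deriv]
  push_cast
  field_simp
  ring

theorem pdx1_q0 {η : ℝ × ℝ → ℝ} (hη : ContDiff ℝ 2 η) (hpos : ∀ x, 0 < η x)
    (x : ℝ × ℝ) : pdx1 (q0 η) x = 12 * pdx1 η x / η x ^ 3 :=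
  deriv_neg_six_div_sq (f := fun s => η (s, x.2))
    ((hη.comp (contDiff_id.prodMk contDiff_const)).differentiable (by norm_num))
    (fun _ => hpos _) x.1

theorem pdx2_q0 {η : ℝ × ℝ → ℝ} (hη : ContDiff ℝ 2 η) (hpos : ∀ x, 0 < η x)
    (x : ℝ × ℝ) : pdx2 (q0 η) x = 12 * pdx2 η x / η x ^ 3 :=
  deriv_neg_six_div_sq (f := fun s => η (x.1, s))
    ((hη.comp (contDiff_const.prodMk contDiff_id)).differentiable (by norm_num))
    (fun _ => hpos _) x.2

theorem lapx_q0 {η : ℝ × ℝ → ℝ} (hη : ContDiff ℝ 2 η) (hpos : ∀ x, 0 < η x)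
    (x : ℝ × ℝ) :
    lapx (q0 η) x = 12 * lapx η x / η x ^ 3 - 36 * gradSq η x / η x ^ 4 := by
  have h₁ : pdx1 (pdx1 (q0 η)) x =
      12 * pdx1 (pdx1 η) x / η x ^ 3 - 36 * pdx1 η x ^ 2 / η x ^ 4 :=
    deriv_deriv_neg_six_div_sq (f := fun s => η (s, x.2))
      (hη.comp (contDiff_id.prodMk contDiff_const)) (fun _ => hpos _) x.1
  have h₂ : pdx2 (pdx2 (q0 η)) x =
      12 * pdx2 (pdx2 η) x / η x ^ 3 - 36 * pdx2 η x ^ 2 / η x ^ 4 :=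
    deriv_deriv_neg_six_div_sq (f := fun s => η (x.1, s))
      (hη.comp (contDiff_const.prodMk contDiff_id)) (fun _ => hpos _) x.2
  rw [lapx, h₁, h₂, lapx, gradSq]
  ring

theorem w1_sq_add_w2_sq_le {η : ℝ × ℝ → ℝ} (hη : ContDiff ℝ 2 η) (hpos : ∀ x, 0 < η x)
    (x : ℝ × ℝ) {z : ℝ} (hz : z ∈ Set.Ioo 0 (η x)) :
    w1 η x z ^ 2 + w2 η x z ^ 2 ≤ 36 * (gradSq η x / η x ^ 2) := by
  have hx := hpos x
  obtain ⟨t, rfl⟩ : ∃ t, z = η x * t := ⟨z / η x, by field_simp⟩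
  have ht₀ : 0 < t := pos_of_mul_pos_right hz.1 hx.le
  have ht₁ : t < 1 := by nlinarith [hz.2]
  have hw : w1 η x (η x * t) ^ 2 + w2 η x (η x * t) ^ 2 =
      (t * (1 - t)) ^ 2 * (36 * (gradSq η x / η x ^ 2)) := by
    rw [w1, w2, pdx1_q0 hη hpos, pdx2_q0 hη hpos, gradSq]
    field_simp
    ring
  rw [hw]
  have hG : 0 ≤ gradSq η x := by unfold gradSq; positivity
  refine mul_le_of_le_one_left (by positivity) (pow_le_one₀ ?_ ?_) <;> nlinarith

theorem w3_sq_le {η : ℝ × ℝ → ℝ} (hη : ContDiff ℝ 2 η) (hpos : ∀ x, 0 < η x)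
    (x : ℝ × ℝ) {z : ℝ} (hz : z ∈ Set.Ioo 0 (η x)) :
    w3 η x z ^ 2 ≤ 2 * lapx η x ^ 2 + 18 * (gradSq η x ^ 2 / η x ^ 2) := by
  have hx := hpos x
  obtain ⟨t, rfl⟩ : ∃ t, z = η x * t := ⟨z / η x, by field_simp⟩
  have ht₀ : 0 < t := pos_of_mul_pos_right hz.1 hx.le
  have ht₁ : t < 1 := by nlinarith [hz.2]
  have hw : w3 η x (η x * t) = t ^ 2 * (3 - 2 * t) * lapx η x +
      3 * (t ^ 2 - t ^ 2 * (3 - 2 * t)) * (gradSq η x / η x) := by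
    rw [w3, lapx_q0 hη hpos, pdx1_q0 hη hpos, pdx2_q0 hη hpos, gradSq]
    field_simp
    ring
  rw [hw, ← div_pow]
  set p := t ^ 2 * (3 - 2 * t) with hp
  have hp₀ : 0 ≤ p := mul_nonneg (sq_nonneg t) (by linarith)
  have hp₁ : p ≤ 1 := by nlinarith [mul_nonneg (sq_nonneg (1 - t)) (by linarith : 0 ≤ 1 + 2 * t)]
  have hp_sq : p ^ 2 ≤ 1 := pow_le_one₀ hp₀ hp₁
  have hr_sq : (t ^ 2 - p) ^ 2 ≤ 1 := by
    rw [sq_le_one_iff_abs_le_one, abs_le]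
    constructor <;> nlinarith [sq_nonneg t]
  calc _ ≤ 2 * ((p * lapx η x) ^ 2 + (3 * (t ^ 2 - p) * (gradSq η x / η x)) ^ 2) := add_sq_le
    _ = 2 * (p ^ 2 * lapx η x ^ 2) + 18 * ((t ^ 2 - p) ^ 2 * (gradSq η x / η x) ^ 2) := by ring
    _ ≤ _ := by
      gcongr <;> exact mul_le_of_le_one_left (sq_nonneg _) ‹_›

/-- There is a universal constant `C > 0` such that for every smooth positive `η` and every `x`,
`∫₀^{η(x)} |w|² dz ≤ C·(|∇_xη|²/η + |∇_xη|⁴/η + η|Δ_xη|²)`. -/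
theorem w_l2_bound : ∃ C : ℝ, 0 < C ∧
    ∀ (η : ℝ × ℝ → ℝ), ContDiff ℝ (⊤ : ℕ∞) η → (∀ x, 0 < η x) →
      ∀ x : ℝ × ℝ,
        ∫ z in Set.Ioo (0 : ℝ) (η x),
            ((w1 η x z) ^ 2 + (w2 η x z) ^ 2 + (w3 η x z) ^ 2) ≤
          C * (gradSq η x / η x + (gradSq η x) ^ 2 / η x + η x * (lapx η x) ^ 2) := by
  refine ⟨36, by norm_num, fun η hη hpos x => ?_⟩
  have hη₂ : ContDiff ℝ 2 η := contDiff_infty.1 hη 2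
  have hx := hpos x
  set K := 36 * (gradSq η x / η x ^ 2 + gradSq η x ^ 2 / η x ^ 2 + lapx η x ^ 2) with hK
  have hbound : ∀ z ∈ Set.Ioo 0 (η x),
      ‖w1 η x z ^ 2 + w2 η x z ^ 2 + w3 η x z ^ 2‖ ≤ K := fun z hz => by
    rw [Real.norm_of_nonneg (by positivity)]
    have h₁₂ := w1_sq_add_w2_sq_le hη₂ hpos x hz
    have h₃ := w3_sq_le hη₂ hpos x hz
    have hG : 0 ≤ gradSq η x ^ 2 / η x ^ 2 := by positivity
    have hL := sq_nonneg (lapx η x)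
    linarith
  calc _ ≤ K * MeasureTheory.volume.real (Set.Ioo 0 (η x)) :=
        (Real.le_norm_self _).trans
          (MeasureTheory.norm_setIntegral_le_of_norm_le_const measure_Ioo_lt_top hbound)
    _ = _ := by
      rw [Real.volume_real_Ioo_of_le hx.le, hK]
      field_simp
      ring
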